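/- A Riemannian metric g on a 3-manifold M is locally conformally flat if and only if its Cotton form cott(g) = d^∇ Sch vanishes identically. -/

import Mathlib

open scoped BigOperators
noncomputable section

/-- Points of a chart of a 3-manifold. -/
abbrev E3 := Fin 3 → ℝ

/-- A Riemannian metric in a chart: components `g x i j` at each point. -/
abbrev Metric3 := E3 → Fin 3 → Fin 3 → ℝ

/-- Partial derivative in the `k`-th coordinate direction. -/
def pd (k : Fin 3) (h : E3 → ℝ) (x : E3) : ℝ :=
  fderiv ℝ h x (Pi.single k 1)

/-- Components `g^{ij}` of the inverse metric. -/
def ginv (g : Metric3) (x : E3) (i j : Fin 3) : ℝ :=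
  (Matrix.of (g x))⁻¹ i j

/-- Christoffel symbols `Γ^k_{ij}` of the Levi-Civita connection of `g`. -/
def Gamma (g : Metric3) (x : E3) (k i j : Fin 3) : ℝ :=
  (1 / 2) * ∑ l, ginv g x k l *
    (pd i (fun y => g y j l) x + pd j (fun y => g y i l) x - pd l (fun y => g y i j) x)

/-- Components of the Riemann curvature tensor:
`Riemann g x l i j k` is the `l`-th component of `R(∂_i,∂_j)∂_k`. -/
def Riemann (g : Metric3) (x : E3) (l i j k : Fin 3) : ℝ :=
  pd i (fun y => Gamma g y l j k) x - pd j (fun y => Gamma g y l i k) x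
    + ∑ m, Gamma g x l i m * Gamma g x m j k
    - ∑ m, Gamma g x l j m * Gamma g x m i k

/-- The Ricci tensor `Ric(U,V) = tr (X ↦ R(X,U)V)`. -/
def Ricci (g : Metric3) (x : E3) (i j : Fin 3) : ℝ := ∑ l, Riemann g x l l i j

/-- The scalar curvature, the `g`-trace of the Ricci tensor. -/
def Scal (g : Metric3) (x : E3) : ℝ := ∑ i, ∑ j, ginv g x i j * Ricci g x i j

/-- The Schouten tensor in dimension 3: `Sch = Ric - (scal/4) g`. -/
def Schouten (g : Metric3) (x : E3) (i j : Fin 3) : ℝ :=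
  Ricci g x i j - Scal g x / 4 * g x i j

/-- The covariant derivative `(∇_{∂_k} T)(∂_i, ∂_j)` of a 2-tensor field `T`. -/
def covDeriv (g : Metric3) (T : E3 → Fin 3 → Fin 3 → ℝ) (k : Fin 3) (x : E3)
    (i j : Fin 3) : ℝ :=
  pd k (fun y => T y i j) x - ∑ m, Gamma g x m k i * T x m j
    - ∑ m, Gamma g x m k j * T x i m

/-- The Cotton form `cott = d^∇ Sch`, as an all-covariant 3-tensor:
`CottonForm g x k i j = (d^∇ Sch)(∂_k, ∂_i)(∂_j) = (∇_k Sch)(i,j) - (∇_i Sch)(k,j)`. -/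
def CottonForm (g : Metric3) (x : E3) (k i j : Fin 3) : ℝ :=
  covDeriv g (fun y => Schouten g y) k x i j - covDeriv g (fun y => Schouten g y) i x k j

/-- The Levi-Civita alternating symbol on three indices. -/
def eps3 (a b c : Fin 3) : ℝ :=
  if (a, b, c) = (0, 1, 2) ∨ (a, b, c) = (1, 2, 0) ∨ (a, b, c) = (2, 0, 1) then 1
  else if (a, b, c) = (0, 2, 1) ∨ (a, b, c) = (2, 1, 0) ∨ (a, b, c) = (1, 0, 2) then -1
  else 0

/-- The Cotton tensor `Cott = * d^∇ Sch`, the Hodge star (of the oriented chart) being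
applied to the 2-form part of the Cotton form. -/
def CottonTensor (g : Metric3) (x : E3) (m j : Fin 3) : ℝ :=
  Real.sqrt (Matrix.of (g x)).det / 2 *
    ∑ a, ∑ b, ∑ k, ∑ i, eps3 a b m * ginv g x a k * ginv g x b i * CottonForm g x k i j

/-- `g` is a (smooth) Riemannian metric: smooth, symmetric, positive definite. -/
structure IsRiemannian (g : Metric3) : Prop where
  smooth : ContDiff ℝ (⊤ : ℕ∞) g
  symm : ∀ x i j, g x i j = g x j i
  posdef : ∀ x, (Matrix.of (g x)).PosDef


section Frobenius
open Set Metric Filter Topology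

variable {P N : Type*} [NormedAddCommGroup P] [NormedSpace ℝ P]
  [NormedAddCommGroup N] [NormedSpace ℝ N]

theorem frob_bounds {W : Type*} [NormedAddCommGroup W] [NormedSpace ℝ W]
    {M : Type*} [NormedAddCommGroup M] [NormedSpace ℝ M]
    (F : W → M) (hF : ContDiff ℝ 2 F) (p₀ : W) :
    ∃ ρ > 0, ∃ C : ℝ, 1 ≤ C ∧ (∀ p ∈ closedBall p₀ ρ, ‖F p‖ ≤ C) ∧
      (∀ p ∈ closedBall p₀ ρ, ‖fderiv ℝ F p‖ ≤ C) ∧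
      (∀ p ∈ closedBall p₀ ρ, ∀ q ∈ closedBall p₀ ρ, ‖F q - F p‖ ≤ C * ‖q - p‖) ∧
      (∀ p ∈ closedBall p₀ ρ, ∀ q ∈ closedBall p₀ ρ,
        ‖F q - F p - fderiv ℝ F p (q - p)‖ ≤ C * ‖q - p‖ ^ 2) := by
  have hD : ContDiff ℝ 1 (fderiv ℝ F) := hF.fderiv_right (by norm_num)
  obtain ⟨K, s, hs, hK⟩ := (hF.of_le (by norm_num : (1 : WithTop ℕ∞) ≤ 2)).contDiffAt
    (x := p₀) |>.exists_lipschitzOnWith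
  obtain ⟨K', s', hs', hK'⟩ := hD.contDiffAt (x := p₀) |>.exists_lipschitzOnWith
  obtain ⟨ρ, hρ, hsub⟩ := Metric.nhds_basis_closedBall.mem_iff.1 (inter_mem hs hs')
  have hdiff : Differentiable ℝ F := hF.differentiable (by norm_num)
  have hp₀ : p₀ ∈ closedBall p₀ ρ := mem_closedBall_self hρ.le
  have a1 : (0 : ℝ) ≤ K := K.2
  have a2 : (0 : ℝ) ≤ K' := K'.2
  have a3 : 0 ≤ K * ρ := by positivity
  have a4 : 0 ≤ K' * ρ := by positivity
  refine ⟨ρ, hρ, 1 + K + K' + ‖F p₀‖ + K * ρ + ‖fderiv ℝ F p₀‖ + K' * ρ, ?_, ?_, ?_, ?_, ?_⟩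
  · have := norm_nonneg (F p₀); have := norm_nonneg (fderiv ℝ F p₀); linarith
  · intro p hp
    have h1 := hK.norm_sub_le (hsub hp).1 (hsub hp₀).1
    have h2 : ‖p - p₀‖ ≤ ρ := by simpa [dist_eq_norm] using hp
    have h3 := norm_le_norm_add_norm_sub' (F p) (F p₀)
    have h4 : K * ‖p - p₀‖ ≤ K * ρ := by gcongr
    have := norm_nonneg (fderiv ℝ F p₀)
    linarith
  · intro p hp
    have h1 := hK'.norm_sub_le (hsub hp).2 (hsub hp₀).2
    have h2 : ‖p - p₀‖ ≤ ρ := by simpa [dist_eq_norm] using hp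
    have h3 := norm_le_norm_add_norm_sub' (fderiv ℝ F p) (fderiv ℝ F p₀)
    have h4 : K' * ‖p - p₀‖ ≤ K' * ρ := by gcongr
    have := norm_nonneg (F p₀)
    linarith
  · intro p hp q hq
    have h1 := hK.norm_sub_le (hsub hq).1 (hsub hp).1
    refine h1.trans ?_
    gcongr
    have := norm_nonneg (F p₀); have := norm_nonneg (fderiv ℝ F p₀); linarith
  · intro p hp q hq
    have key : ‖F q - F p - fderiv ℝ F p (q - p)‖ ≤ (K' * ‖q - p‖) * ‖q - p‖ := by
      apply Convex.norm_image_sub_le_of_norm_fderiv_le' (𝕜 := ℝ) (s := segment ℝ p q)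
      · intro x _; exact hdiff x
      · intro x hx
        have hx' : x ∈ closedBall p₀ ρ := (convex_closedBall p₀ ρ).segment_subset hp hq hx
        refine (hK'.norm_sub_le (hsub hx').2 (hsub hp).2).trans ?_
        gcongr
        exact norm_sub_le_of_mem_segment hx
      · exact convex_segment p q
      · exact left_mem_segment ℝ p q
      · exact right_mem_segment ℝ p q
    refine key.trans ?_
    rw [mul_assoc, ← sq]
    gcongr
    have := norm_nonneg (F p₀); have := norm_nonneg (fderiv ℝ F p₀); linarith

theorem frob_ode [CompleteSpace N] (v : ℝ → N → N) (y₀ : N) (a L K : NNReal)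
    (hL : ∀ t ∈ Icc (0:ℝ) 1, LipschitzOnWith K (v t) (closedBall y₀ a))
    (hc : ∀ x ∈ closedBall y₀ a, ContinuousOn (v · x) (Icc 0 1))
    (hn : ∀ t ∈ Icc (0:ℝ) 1, ∀ x ∈ closedBall y₀ a, ‖v t x‖ ≤ L) (hLa : L ≤ a) :
    ∃ y : ℝ → N, y 0 = y₀ ∧ Continuous y ∧ (∀ t, y t ∈ closedBall y₀ a) ∧
      ∀ t ∈ Icc (0:ℝ) 1, HasDerivWithinAt y (v t (y t)) (Icc 0 1) t := by
  have hf : IsPicardLindelof v (⟨0, by simp⟩ : Icc (0:ℝ) 1) y₀ a 0 L K :=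
    ⟨hL, hc, hn, by simpa using hLa⟩
  have hx : y₀ ∈ closedBall y₀ ((0 : NNReal) : ℝ) := mem_closedBall_self le_rfl
  obtain ⟨α, hα⟩ := ODE.FunSpace.exists_isFixedPt_next hf hx
  refine ⟨α.compProj, ?_, α.continuous_compProj,
    fun t => α.compProj_mem_closedBall hf.mul_max_le, fun t ht ↦ ?_⟩
  · have := ODE.FunSpace.next_apply₀ hf hx α
    rw [hα] at this
    rw [ODE.FunSpace.compProj_of_mem (by simp)]
    exact this
  apply ODE.hasDerivWithinAt_picard_Icc (t₀ := (0:ℝ)) (by simp) hf.continuousOn_uncurry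
    α.continuous_compProj.continuousOn (fun _ ht' ↦ α.compProj_mem_closedBall hf.mul_max_le)
    y₀ ht |>.congr_of_mem _ ht
  intro t' ht'
  nth_rw 1 [← hα]
  rw [ODE.FunSpace.compProj_of_mem ht', ODE.FunSpace.next_apply]

theorem frob_zero [CompleteSpace N] (F : P × N → P →L[ℝ] N) (hF : ContDiff ℝ 2 F)
    (hcompat : ∀ (p : P × N) (u v : P), fderiv ℝ F p (u, F p u) v = fderiv ℝ F p (v, F p v) u)
    (y₀ : N) :
    ∃ r > 0, ∃ Y : P → N, Y 0 = y₀ ∧ ∀ u ∈ ball (0 : P) r, HasFDerivAt Y (F (u, Y u)) u := by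
  obtain ⟨ρ, hρ, C, hC1, hb, hDb, hLip, hTay⟩ := frob_bounds F hF ((0 : P), y₀)
  have hC0 : 0 < C := by linarith
  have hdiff : Differentiable ℝ F := hF.differentiable (by norm_num)
  have hcont : Continuous F := hF.continuous
  have hmem : ∀ (x : P) (y : N), ‖x‖ ≤ ρ → y ∈ closedBall y₀ ρ →
      (x, y) ∈ closedBall ((0 : P), y₀) ρ := by
    intro x y hx hy
    rw [mem_closedBall, Prod.dist_eq]
    exact max_le (by simpa using hx) hy
  obtain ⟨r, hr, hr1, hrρ, hCr⟩ : ∃ r > 0, r ≤ 1 ∧ r ≤ ρ ∧ C * r ≤ ρ / 2 := by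
    refine ⟨min 1 (min ρ (ρ / 2 / C)), by positivity, min_le_left _ _,
      (min_le_right _ _).trans (min_le_left _ _), ?_⟩
    calc C * min 1 (min ρ (ρ / 2 / C)) ≤ C * (ρ / 2 / C) := by
          gcongr; exact (min_le_right _ _).trans (min_le_right _ _)
      _ = ρ / 2 := by field_simp
  have htu : ∀ u ∈ ball (0 : P) r, ∀ t ∈ Icc (0:ℝ) 1, ‖t • u‖ ≤ r := by
    intro u hu t ht
    rw [norm_smul, Real.norm_of_nonneg ht.1]
    have : ‖u‖ ≤ r := by simpa using (mem_ball_zero_iff.1 hu).le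
    nlinarith [ht.2, ht.1, norm_nonneg u]
  have hvlip : ∀ u ∈ ball (0 : P) r, ∀ t ∈ Icc (0:ℝ) 1,
      LipschitzOnWith ⟨C, hC0.le⟩ (fun y => F (t • u, y) u) (closedBall y₀ ρ) := by
    intro u hu t ht
    apply LipschitzOnWith.of_dist_le_mul
    intro y hy z hz
    rw [dist_eq_norm, dist_eq_norm, ← sub_apply]
    have hun : ‖u‖ ≤ 1 := by have := mem_ball_zero_iff.1 hu; linarith
    have h1 := hLip _ (hmem (t • u) z ((htu u hu t ht).trans hrρ) hz) _
      (hmem (t • u) y ((htu u hu t ht).trans hrρ) hy)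
    have h2 : ‖((t • u, y) : P × N) - (t • u, z)‖ = ‖y - z‖ := by simp
    rw [h2] at h1
    calc _ ≤ ‖F (t • u, y) - F (t • u, z)‖ * ‖u‖ := ContinuousLinearMap.le_opNorm _ _
      _ ≤ (C * ‖y - z‖) * 1 := by gcongr
      _ = _ := by rw [mul_one]; rfl
  have hex : ∀ u : P, ∃ y : ℝ → N, u ∈ ball (0 : P) r → (y 0 = y₀ ∧ Continuous y ∧
      (∀ t, y t ∈ closedBall y₀ (ρ / 2)) ∧
      ∀ t ∈ Icc (0:ℝ) 1, HasDerivWithinAt y (F (t • u, y t) u) (Icc 0 1) t) := by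
    intro u
    by_cases hu : u ∈ ball (0 : P) r
    swap
    · exact ⟨fun _ => 0, fun h => absurd h hu⟩
    have hsub : closedBall y₀ (ρ / 2) ⊆ closedBall y₀ ρ := closedBall_subset_closedBall (by linarith)
    obtain ⟨y, h⟩ := frob_ode (fun t y => F (t • u, y) u) y₀ ⟨ρ / 2, by positivity⟩
      ⟨C * r, by positivity⟩ ⟨C, hC0.le⟩ (fun t ht => (hvlip u hu t ht).mono hsub)
      (fun x _ => by fun_prop)
      (fun t ht y hy => by
        have hun : ‖u‖ ≤ r := (mem_ball_zero_iff.1 hu).le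
        calc _ ≤ ‖F (t • u, y)‖ * ‖u‖ := ContinuousLinearMap.le_opNorm _ _
          _ ≤ C * r := by
            gcongr
            exact hb _ (hmem _ _ ((htu u hu t ht).trans hrρ) (hsub hy))) hCr
    exact ⟨y, fun _ => h⟩
  choose y hy using hex
  have hest : ∀ u ∈ ball (0 : P) r, ∀ h : P, u + h ∈ ball (0 : P) r → C * ‖h‖ ≤ ρ / 2 →
      ‖y (u + h) 1 - y u 1 - F (u, y u 1) h‖ ≤
        gronwallBound 0 C ((C * (1 + C) + C * (1 + C) ^ 2) * ‖h‖ ^ 2) 1 := by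
    intro u hu h huh hh
    obtain ⟨hy0, hyc, hyb, hyd⟩ := hy u hu
    obtain ⟨hw0, hwc, hwb, hwd⟩ := hy (u + h) huh
    have hsub : closedBall y₀ (ρ / 2) ⊆ closedBall y₀ ρ := closedBall_subset_closedBall (by linarith)
    have hp : ∀ t ∈ Icc (0:ℝ) 1, (t • u, y u t) ∈ closedBall ((0 : P), y₀) ρ := fun t ht =>
      hmem _ _ ((htu u hu t ht).trans hrρ) (hsub (hyb t))
    have hth : ∀ t ∈ Icc (0:ℝ) 1, ‖t • h‖ ≤ ‖h‖ := by
      intro t ht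
      rw [norm_smul, Real.norm_of_nonneg ht.1]
      nlinarith [ht.2, ht.1, norm_nonneg h]
    have hFh : ∀ t ∈ Icc (0:ℝ) 1, ‖F (t • u, y u t) (t • h)‖ ≤ C * ‖h‖ := by
      intro t ht
      calc _ ≤ ‖F (t • u, y u t)‖ * ‖t • h‖ := ContinuousLinearMap.le_opNorm _ _
        _ ≤ C * ‖h‖ := by
          gcongr
          · exact hb _ (hp t ht)
          · exact hth t ht
    set z : ℝ → N := fun t => y u t + F (t • u, y u t) (t • h) with hz
    have hzb : ∀ t ∈ Icc (0:ℝ) 1, z t ∈ closedBall y₀ ρ := by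
      intro t ht
      have h1 := hyb t
      have h2 := hFh t ht
      rw [mem_closedBall, dist_eq_norm] at h1 ⊢
      have h3 : z t - y₀ = (y u t - y₀) + F (t • u, y u t) (t • h) := by simp only [hz]; abel
      rw [h3]
      refine (norm_add_le _ _).trans ?_
      linarith
    have hIci : ∀ {f : ℝ → N} {f' : N} {t : ℝ}, t ∈ Ico (0:ℝ) 1 →
        HasDerivWithinAt f f' (Icc 0 1) t → HasDerivWithinAt f f' (Ici t) t := by
      intro f f' t ht hf
      exact hf.mono_of_mem_nhdsWithin (Icc_mem_nhdsGE_of_mem ht)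
    have hzd : ∀ t ∈ Ico (0:ℝ) 1, HasDerivWithinAt z (F (t • u, y u t) u +
        (fderiv ℝ F (t • u, y u t) (u, F (t • u, y u t) u) (t • h) + F (t • u, y u t) h))
        (Ici t) t := by
      intro t ht
      have hy' := hIci ht (hyd t (Ico_subset_Icc_self ht))
      have hu' : HasDerivWithinAt (fun t : ℝ => t • u) u (Ici t) t := by
        simpa using ((hasDerivAt_id t).smul_const u).hasDerivWithinAt
      have hh' : HasDerivWithinAt (fun t : ℝ => t • h) h (Ici t) t := by
        simpa using ((hasDerivAt_id t).smul_const h).hasDerivWithinAt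
      have hc := (hdiff (t • u, y u t)).hasFDerivAt.comp_hasDerivWithinAt t (hu'.prodMk hy')
      exact hy'.add (hc.clm_apply hh')
    have := dist_le_of_approx_trajectories_ODE_of_mem (v := fun t y => F (t • (u + h), y) (u + h))
      (K := ⟨C, hC0.le⟩) (s := fun _ => closedBall y₀ ρ) (a := 0) (b := 1)
      (f := y (u + h)) (g := z) (δ := 0) (εf := 0)
      (εg := (C * (1 + C) + C * (1 + C) ^ 2) * ‖h‖ ^ 2)
      (fun t ht => hvlip _ huh t (Ico_subset_Icc_self ht)) hwc.continuousOn
      (fun t ht => hIci ht (hwd t (Ico_subset_Icc_self ht)))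
      (fun t ht => by simp) (fun t _ => hsub (hwb t))
      (by fun_prop) hzd ?_ (fun t ht => hzb t (Ico_subset_Icc_self ht)) (by simp [hz, hy0, hw0])
      1 (by simp)
    · have e : y (u + h) 1 - y u 1 - F (u, y u 1) h = y (u + h) 1 - z 1 := by
        simp [hz]; abel
      rw [e, ← dist_eq_norm]
      simp only [zero_add, sub_zero] at this
      exact this
    · intro t ht'
      have ht := Ico_subset_Icc_self ht'
      set p : P × N := (t • u, y u t) with hpdef
      have hq : (t • (u + h), z t) ∈ closedBall ((0 : P), y₀) ρ :=
        hmem _ _ ((htu _ huh t ht).trans hrρ) (hzb t ht)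
      have hqp : ((t • (u + h), z t) : P × N) - p = (t • h, F p (t • h)) := by
        simp [hpdef, hz, smul_add]
      have hT := hTay p (hp t ht) _ hq
      rw [hqp] at hT
      have hnq : ‖((t • h, F p (t • h)) : P × N)‖ ≤ (1 + C) * ‖h‖ := by
        rw [Prod.norm_def]
        refine max_le ?_ ?_
        · have := hth t ht
          have := mul_nonneg hC0.le (norm_nonneg h)
          simp only; linarith
        · have := hFh t ht
          have := norm_nonneg h
          simp only; linarith
      set R := F (t • (u + h), z t) - F p - fderiv ℝ F p (t • h, F p (t • h)) with hR
      have hFq : F (t • (u + h), z t) = F p + fderiv ℝ F p (t • h, F p (t • h)) + R := by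
        rw [hR]; abel
      have hi := hcompat p u (t • h)
      rw [dist_eq_norm, hFq, hi]
      have e : F p u + (fderiv ℝ F p (t • h, F p (t • h)) u + F p h) -
          (F p + fderiv ℝ F p (t • h, F p (t • h)) + R) (u + h) =
          - (fderiv ℝ F p (t • h, F p (t • h)) h + R (u + h)) := by
        simp only [add_apply, map_add]; abel
      rw [e, norm_neg]
      have huh1 : ‖u + h‖ ≤ 1 := by have := mem_ball_zero_iff.1 huh; linarith
      calc _ ≤ ‖fderiv ℝ F p (t • h, F p (t • h)) h‖ + ‖R (u + h)‖ := norm_add_le _ _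
        _ ≤ ‖fderiv ℝ F p (t • h, F p (t • h))‖ * ‖h‖ + ‖R‖ * ‖u + h‖ := by
          gcongr <;> exact ContinuousLinearMap.le_opNorm _ _
        _ ≤ (C * ((1 + C) * ‖h‖)) * ‖h‖ + (C * ((1 + C) * ‖h‖) ^ 2) * 1 := by
          gcongr
          · refine (ContinuousLinearMap.le_opNorm _ _).trans ?_
            gcongr
            exact hDb p (hp t ht)
          · refine hT.trans ?_
            gcongr
        _ = _ := by ring
  refine ⟨r, hr, fun u => y u 1, ?_, ?_⟩
  · have h0 : (0 : P) ∈ ball (0 : P) r := mem_ball_self hr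
    obtain ⟨h1, h2, h3, h4⟩ := hy 0 h0
    have := constant_of_has_deriv_right_zero (f := y 0) (a := 0) (b := 1) h2.continuousOn
      (fun t ht => by
        have := (h4 t (Ico_subset_Icc_self ht)).mono_of_mem_nhdsWithin (Icc_mem_nhdsGE_of_mem ht)
        simpa using this) 1 (by simp)
    simpa [h1] using this
  · intro u hu
    rw [hasFDerivAt_iff_isLittleO_nhds_zero]
    refine Asymptotics.IsBigO.trans_isLittleO (g := fun h : P => ‖h‖ ^ 2) ?_ ?_
    · refine Asymptotics.IsBigO.of_bound
        ((C * (1 + C) + C * (1 + C) ^ 2) / C * (Real.exp (C * 1) - 1)) ?_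
      have e1 : ∀ᶠ h : P in 𝓝 0, u + h ∈ ball (0 : P) r := by
        have : Tendsto (fun h : P => u + h) (𝓝 0) (𝓝 u) := by
          have : Continuous (fun h : P => u + h) := by fun_prop
          simpa using this.tendsto 0
        exact this (isOpen_ball.mem_nhds hu)
      have e2 : ∀ᶠ h : P in 𝓝 0, C * ‖h‖ ≤ ρ / 2 := by
        have : Tendsto (fun h : P => C * ‖h‖) (𝓝 0) (𝓝 0) := by
          have : Continuous (fun h : P => C * ‖h‖) := by fun_prop
          simpa using this.tendsto 0
        exact (this (Iic_mem_nhds (by positivity : (0:ℝ) < ρ / 2)))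
      filter_upwards [e1, e2] with h h1 h2
      refine (hest u hu h h1 h2).trans (le_of_eq ?_)
      rw [gronwallBound_of_K_ne_0 hC0.ne']
      simp only [norm_pow, norm_norm]
      ring
    · exact Asymptotics.isLittleO_norm_pow_id one_lt_two

theorem frob_main [CompleteSpace N] (F : P × N → P →L[ℝ] N) (hF : ContDiff ℝ 2 F)
    (hcompat : ∀ (p : P × N) (u v : P), fderiv ℝ F p (u, F p u) v = fderiv ℝ F p (v, F p v) u)
    (x₀ : P) (y₀ : N) :
    ∃ V : Set P, IsOpen V ∧ x₀ ∈ V ∧ ∃ Y : P → N, ∀ u ∈ V, HasFDerivAt Y (F (u, Y u)) u := by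
  have hs : ∀ p : P × N, HasFDerivAt (fun q : P × N => F (q + (x₀, 0))) (fderiv ℝ F (p + (x₀, 0))) p := by
    intro p
    have h1 := ((hF.differentiable (by norm_num)) (p + (x₀, 0))).hasFDerivAt
    have h2 := h1.comp p ((hasFDerivAt_id p).add_const (x₀, (0 : N)))
    rw [ContinuousLinearMap.comp_id] at h2
    exact h2
  obtain ⟨r, hr, Y, -, hY⟩ := frob_zero (fun q => F (q + (x₀, 0))) (by fun_prop) (by
    intro p u v
    rw [(hs p).fderiv]
    exact hcompat _ u v) y₀
  refine ⟨ball x₀ r, isOpen_ball, mem_ball_self hr, fun x => Y (x - x₀), ?_⟩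
  intro u hu
  have hu' : u - x₀ ∈ ball (0 : P) r := by simpa [dist_eq_norm] using hu
  have := hY _ hu'
  simp only [Prod.mk_add_mk, sub_add_cancel, add_zero] at this
  have h2 := this.comp u ((hasFDerivAt_id u).sub_const x₀)
  rw [ContinuousLinearMap.comp_id] at h2
  exact h2

theorem frob_smooth (F : P × N → P →L[ℝ] N) (hF : ContDiff ℝ (⊤ : ℕ∞) F) (V : Set P)
    (hV : IsOpen V) (Y : P → N) (hY : ∀ u ∈ V, HasFDerivAt Y (F (u, Y u)) u) :
    ContDiffOn ℝ (⊤ : ℕ∞) Y V := by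
  have hd : DifferentiableOn ℝ Y V := fun u hu => (hY u hu).differentiableAt.differentiableWithinAt
  have : ∀ n : ℕ, ContDiffOn ℝ n Y V := by
    intro n
    induction n with
    | zero => exact contDiffOn_zero.2 hd.continuousOn
    | succ n ih =>
      push_cast
      rw [contDiffOn_succ_iff_fderiv_of_isOpen hV]
      refine ⟨hd, by simp, ?_⟩
      have h1 : ContDiffOn ℝ n (fun u => F (u, Y u)) V :=
        (hF.of_le (by exact_mod_cast le_top)).comp_contDiffOn (contDiffOn_id.prodMk ih)
      exact h1.congr fun u hu => (hY u hu).fderiv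
  exact contDiffOn_infty.2 this

end Frobenius

section Geometry

/-- Kronecker delta. -/
def dl (i j : Fin 3) : ℝ := if i = j then 1 else 0

theorem dl_comm (i j : Fin 3) : dl i j = dl j i := by simp [dl, eq_comm]

theorem sum_dl_mul (i : Fin 3) (T : Fin 3 → ℝ) : ∑ m, dl i m * T m = T i := by simp [dl]

theorem sum_mul_dl (i : Fin 3) (T : Fin 3 → ℝ) : ∑ m, T m * dl m i = T i := by simp [dl]

theorem pd_congr {k : Fin 3} {a b : E3 → ℝ} {x : E3} (h : a =ᶠ[nhds x] b) : pd k a x = pd k b x := by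
  unfold pd; rw [h.fderiv_eq]

theorem pd_const (k : Fin 3) (c : ℝ) (x : E3) : pd k (fun _ => c) x = 0 := by simp [pd]

theorem pd_add (k : Fin 3) {a b : E3 → ℝ} {x : E3} (ha : DifferentiableAt ℝ a x)
    (hb : DifferentiableAt ℝ b x) : pd k (fun y => a y + b y) x = pd k a x + pd k b x := by
  unfold pd; rw [fderiv_fun_add ha hb]; rfl

theorem pd_sub (k : Fin 3) {a b : E3 → ℝ} {x : E3} (ha : DifferentiableAt ℝ a x)
    (hb : DifferentiableAt ℝ b x) : pd k (fun y => a y - b y) x = pd k a x - pd k b x := by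
  unfold pd; rw [fderiv_fun_sub ha hb]; rfl

theorem pd_mul (k : Fin 3) {a b : E3 → ℝ} {x : E3} (ha : DifferentiableAt ℝ a x)
    (hb : DifferentiableAt ℝ b x) :
    pd k (fun y => a y * b y) x = pd k a x * b x + a x * pd k b x := by
  unfold pd; rw [fderiv_fun_mul ha hb]; simp; ring

theorem pd_const_mul (k : Fin 3) (c : ℝ) {b : E3 → ℝ} {x : E3}
    (hb : DifferentiableAt ℝ b x) :
    pd k (fun y => c * b y) x = c * pd k b x := by
  rw [pd_mul k (by fun_prop) hb, pd_const]; ring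

theorem pd_neg (k : Fin 3) {a : E3 → ℝ} {x : E3} : pd k (fun y => - a y) x = - pd k a x := by
  unfold pd; rw [fderiv_fun_neg]; rfl

theorem pd_sum (k : Fin 3) {a : Fin 3 → E3 → ℝ} {x : E3} (ha : ∀ m, DifferentiableAt ℝ (a m) x) :
    pd k (fun y => ∑ m, a m y) x = ∑ m, pd k (a m) x := by
  unfold pd; rw [fderiv_fun_sum (fun m _ => ha m)]; simp

theorem pd_sum_mul (k : Fin 3) {a b : Fin 3 → E3 → ℝ} {x : E3}
    (ha : ∀ m, DifferentiableAt ℝ (a m) x) (hb : ∀ m, DifferentiableAt ℝ (b m) x) :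
    pd k (fun y => ∑ m, a m y * b m y) x = ∑ m, (pd k (a m) x * b m x + a m x * pd k (b m) x) := by
  rw [pd_sum k (a := fun m y => a m y * b m y) (fun m => (ha m).mul (hb m))]
  exact Finset.sum_congr rfl fun m _ => pd_mul k (ha m) (hb m)

theorem pd_contDiffAt {h : E3 → ℝ} {x : E3} (hh : ContDiffAt ℝ (⊤ : ℕ∞) h x) (k : Fin 3) :
    ContDiffAt ℝ (⊤ : ℕ∞) (pd k h) x := by
  have : ContDiffAt ℝ (⊤ : ℕ∞) (fderiv ℝ h) x := hh.fderiv_right (by simp)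
  exact this.clm_apply contDiffAt_const

theorem pd_contDiff {h : E3 → ℝ} (hh : ContDiff ℝ (⊤ : ℕ∞) h) (k : Fin 3) :
    ContDiff ℝ (⊤ : ℕ∞) (pd k h) :=
  contDiff_iff_contDiffAt.2 fun _ => pd_contDiffAt hh.contDiffAt k

theorem smAt_diff {h : E3 → ℝ} {x : E3} (hh : ContDiffAt ℝ (⊤ : ℕ∞) h x) : DifferentiableAt ℝ h x :=
  hh.differentiableAt (by simp)

theorem sm_diff {h : E3 → ℝ} (hh : ContDiff ℝ (⊤ : ℕ∞) h) (x : E3) : DifferentiableAt ℝ h x :=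
  smAt_diff hh.contDiffAt

theorem pd_comm {h : E3 → ℝ} {x : E3} (hh : ContDiffAt ℝ (⊤ : ℕ∞) h x) (k l : Fin 3) :
    pd k (pd l h) x = pd l (pd k h) x := by
  have h1 : ContDiffAt ℝ (⊤ : ℕ∞) (fderiv ℝ h) x := hh.fderiv_right (by simp)
  have hd : DifferentiableAt ℝ (fderiv ℝ h) x := h1.differentiableAt (by simp)
  have e : ∀ a b : Fin 3, pd a (pd b h) x =
      fderiv ℝ (fderiv ℝ h) x (Pi.single a 1) (Pi.single b 1) := by
    intro a b
    have : pd b h = fun y => fderiv ℝ h y (Pi.single b 1) := rfl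
    rw [this]
    unfold pd
    rw [fderiv_clm_apply hd (by fun_prop)]
    simp
  rw [e, e]
  have hs : IsSymmSndFDerivAt ℝ h x := hh.isSymmSndFDerivAt (by
    simp only [minSmoothness_of_isRCLikeNormedField]
    exact WithTop.coe_le_coe.2 (le_top : (2 : ℕ∞) ≤ ⊤))
  exact hs _ _

variable {g : Metric3}

theorem sm_g (hg : IsRiemannian g) (i j : Fin 3) : ContDiff ℝ (⊤ : ℕ∞) (fun y => g y i j) := by
  have := hg.smooth
  rw [contDiff_pi] at this
  have h2 := this i
  rw [contDiff_pi] at h2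
  exact h2 j

theorem sm_det (a : E3 → Matrix (Fin 3) (Fin 3) ℝ)
    (ha : ∀ i j, ContDiff ℝ (⊤ : ℕ∞) (fun y => a y i j)) :
    ContDiff ℝ (⊤ : ℕ∞) (fun y => (a y).det) := by
  simp only [Matrix.det_fin_three]
  fun_prop

theorem det_ne (hg : IsRiemannian g) (x : E3) : (Matrix.of (g x)).det ≠ 0 := (hg.posdef x).det_pos.ne'

theorem sm_ginv (hg : IsRiemannian g) (i j : Fin 3) : ContDiff ℝ (⊤ : ℕ∞) (fun y => ginv g y i j) := by
  have h1 : ∀ y, ginv g y i j = ((Matrix.of (g y)).det)⁻¹ *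
      ((Matrix.of (g y)).updateRow j (Pi.single i 1)).det := by
    intro y
    simp [ginv, Matrix.inv_def, Matrix.adjugate_apply]
  simp only [h1]
  refine ContDiff.mul (ContDiff.inv (sm_det _ (fun a b => sm_g hg a b)) (det_ne hg)) ?_
  refine sm_det _ (fun a b => ?_)
  by_cases hab : a = j
  · subst hab; simp only [Matrix.updateRow_self]; exact contDiff_const
  · simp only [Matrix.updateRow_ne hab]; exact sm_g hg a b

theorem sm_Gamma (hg : IsRiemannian g) (k i j : Fin 3) :
    ContDiff ℝ (⊤ : ℕ∞) (fun y => Gamma g y k i j) := by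
  unfold Gamma
  refine contDiff_const.mul (ContDiff.sum fun l _ => (sm_ginv hg k l).mul ?_)
  exact ((pd_contDiff (sm_g hg j l) i).add (pd_contDiff (sm_g hg i l) j)).sub
    (pd_contDiff (sm_g hg i j) l)

theorem sm_Riemann (hg : IsRiemannian g) (l i j k : Fin 3) :
    ContDiff ℝ (⊤ : ℕ∞) (fun y => Riemann g y l i j k) := by
  unfold Riemann
  refine (((pd_contDiff (sm_Gamma hg l j k) i).sub (pd_contDiff (sm_Gamma hg l i k) j)).add
    (ContDiff.sum fun m _ => (sm_Gamma hg l i m).mul (sm_Gamma hg m j k))).sub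
    (ContDiff.sum fun m _ => (sm_Gamma hg l j m).mul (sm_Gamma hg m i k))

theorem sm_Ricci (hg : IsRiemannian g) (i j : Fin 3) :
    ContDiff ℝ (⊤ : ℕ∞) (fun y => Ricci g y i j) :=
  ContDiff.sum fun l _ => sm_Riemann hg l l i j

theorem sm_Scal (hg : IsRiemannian g) : ContDiff ℝ (⊤ : ℕ∞) (fun y => Scal g y) :=
  ContDiff.sum fun i _ => ContDiff.sum fun j _ => (sm_ginv hg i j).mul (sm_Ricci hg i j)

theorem sm_Sch (hg : IsRiemannian g) (i j : Fin 3) :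
    ContDiff ℝ (⊤ : ℕ∞) (fun y => Schouten g y i j) :=
  (sm_Ricci hg i j).sub (((sm_Scal hg).div_const 4).mul (sm_g hg i j))

theorem g_ginv (hg : IsRiemannian g) (x : E3) (i j : Fin 3) :
    ∑ l, g x i l * ginv g x l j = dl i j := by
  have h := Matrix.mul_nonsing_inv (Matrix.of (g x)) (Ne.isUnit (det_ne hg x))
  have h2 := congrFun (congrFun h i) j
  rw [Matrix.mul_apply, Matrix.one_apply] at h2
  exact h2

theorem ginv_symm (hg : IsRiemannian g) (x : E3) (i j : Fin 3) : ginv g x i j = ginv g x j i := by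
  have h : (Matrix.of (g x)).transpose = Matrix.of (g x) := by
    ext a b; exact hg.symm x b a
  have h2 := Matrix.transpose_nonsing_inv (Matrix.of (g x))
  rw [h] at h2
  have := congrFun (congrFun h2 j) i
  exact this

theorem ginv_g (hg : IsRiemannian g) (x : E3) (i j : Fin 3) :
    ∑ l, ginv g x i l * g x l j = dl i j := by
  have h := g_ginv hg x j i
  rw [dl_comm, ← h]
  refine Finset.sum_congr rfl fun l _ => ?_
  rw [ginv_symm hg x i l, hg.symm x l j, mul_comm]

/-- If `M v = w` with `M = g`, then `v = g⁻¹ w`. -/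
theorem raise_lower (hg : IsRiemannian g) (x : E3) (v : Fin 3 → ℝ) (i : Fin 3) :
    ∑ l, ginv g x i l * ∑ m, g x l m * v m = v i := by
  simp only [Finset.mul_sum]
  rw [Finset.sum_comm]
  simp only [← mul_assoc, ← Finset.sum_mul]
  simp only [ginv_g hg, sum_dl_mul]

theorem lower_raise (hg : IsRiemannian g) (x : E3) (v : Fin 3 → ℝ) (i : Fin 3) :
    ∑ l, g x i l * ∑ m, ginv g x l m * v m = v i := by
  simp only [Finset.mul_sum]
  rw [Finset.sum_comm]
  simp only [← mul_assoc, ← Finset.sum_mul]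
  simp only [g_ginv hg, sum_dl_mul]

theorem Gamma_symm (hg : IsRiemannian g) (x : E3) (k i j : Fin 3) :
    Gamma g x k i j = Gamma g x k j i := by
  unfold Gamma
  have : (fun y => g y i j) = fun y => g y j i := funext fun y => hg.symm y i j
  simp only [this]
  congr 1
  refine Finset.sum_congr rfl fun l _ => ?_
  ring

theorem Gamma_low (hg : IsRiemannian g) (x : E3) (k i j : Fin 3) :
    ∑ m, g x j m * Gamma g x m k i = (1 / 2) * (pd k (fun y => g y i j) x +
      pd i (fun y => g y k j) x - pd j (fun y => g y k i) x) := by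
  have := lower_raise hg x (fun l => (1 / 2) * (pd k (fun y => g y i l) x +
      pd i (fun y => g y k l) x - pd l (fun y => g y k i) x)) j
  rw [← this]
  refine Finset.sum_congr rfl fun l _ => ?_
  congr 1
  unfold Gamma
  rw [Finset.mul_sum]
  refine Finset.sum_congr rfl fun m _ => ?_
  ring

theorem compat (hg : IsRiemannian g) (x : E3) (k i j : Fin 3) :
    pd k (fun y => g y i j) x = ∑ m, Gamma g x m k i * g x m j + ∑ m, Gamma g x m k j * g x i m := by
  have h1 := Gamma_low hg x k i j
  have h2 := Gamma_low hg x k j i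
  have e1 : ∑ m, Gamma g x m k i * g x m j = ∑ m, g x j m * Gamma g x m k i :=
    Finset.sum_congr rfl fun m _ => by rw [hg.symm x m j, mul_comm]
  have e2 : ∑ m, Gamma g x m k j * g x i m = ∑ m, g x i m * Gamma g x m k j :=
    Finset.sum_congr rfl fun m _ => by rw [mul_comm]
  have s1 : (fun y => g y i j) = fun y => g y j i := funext fun y => hg.symm y i j
  rw [e1, e2, h1, h2, s1]
  ring

theorem compat_inv (hg : IsRiemannian g) (x : E3) (k i j : Fin 3) :
    pd k (fun y => ginv g y i j) x =
      - (∑ m, Gamma g x i k m * ginv g x m j) - ∑ m, ginv g x i m * Gamma g x j k m := by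
  have hd : ∀ a, ∑ l, (pd k (fun y => g y a l) x * ginv g x l j +
      g x a l * pd k (fun y => ginv g y l j) x) = 0 := by
    intro a
    rw [← pd_sum_mul k (fun m => sm_diff (sm_g hg a m) x) (fun m => sm_diff (sm_ginv hg m j) x)]
    simp only [g_ginv hg]
    exact pd_const _ _ _
  have h1 := raise_lower hg x (fun l => pd k (fun y => ginv g y l j) x) i
  rw [← h1]
  have h2 : ∀ a, ∑ l, g x a l * pd k (fun y => ginv g y l j) x =
      - ∑ l, pd k (fun y => g y a l) x * ginv g x l j := by
    intro a
    have := hd a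
    rw [Finset.sum_add_distrib] at this
    linarith
  simp only [h2, compat hg]
  have h3 : ∀ a, ∑ l, (∑ m, Gamma g x m k a * g x m l + ∑ m, Gamma g x m k l * g x a m) *
      ginv g x l j = Gamma g x j k a + ∑ m, g x a m * ∑ l, Gamma g x m k l * ginv g x l j := by
    intro a
    simp only [add_mul, Finset.sum_add_distrib]
    congr 1
    · rw [← sum_mul_dl j (fun m => Gamma g x m k a)]
      simp only [← g_ginv hg x, Finset.mul_sum, Finset.sum_mul]
      rw [Finset.sum_comm]
      simp only [mul_assoc]
    · simp only [Finset.mul_sum, Finset.sum_mul]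
      rw [Finset.sum_comm]
      refine Finset.sum_congr rfl fun l _ => Finset.sum_congr rfl fun m _ => ?_
      ring
  simp only [h3, mul_neg, mul_add, Finset.sum_neg_distrib, Finset.sum_add_distrib]
  rw [raise_lower hg x (fun m => ∑ l, Gamma g x m k l * ginv g x l j)]
  ring

/-- Curvature with second lower index raised. -/
def Rup (g : Metric3) (x : E3) (l k i j : Fin 3) : ℝ := ∑ a, Riemann g x l i j a * ginv g x a k

theorem Riemann_antisymm (x : E3) (l i j k : Fin 3) : Riemann g x l i j k = - Riemann g x l j i k := by
  unfold Riemann; ring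

theorem Rup_antisymm_right (x : E3) (l k i j : Fin 3) : Rup g x l k i j = - Rup g x l k j i := by
  unfold Rup
  rw [← Finset.sum_neg_distrib]
  exact Finset.sum_congr rfl fun a _ => by rw [Riemann_antisymm x l i j a]; ring

theorem alg_antisymm (A : Fin 3 → Fin 3 → Fin 3 → ℝ) (H : Fin 3 → Fin 3 → ℝ)
    (dA : Fin 3 → Fin 3 → Fin 3 → Fin 3 → ℝ) (l k i j : Fin 3)
    (hH : ∀ a b, H a b = H b a)
    (h : - (∑ m, (dA i l j m * H m k + A l j m * (-(∑ n, A m i n * H n k) - ∑ n, H m n * A k i n)))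
      - (∑ m, ((-(∑ n, A l i n * H n m) - ∑ n, H l n * A m i n) * A k j m + H l m * dA i k j m)) =
      - (∑ m, (dA j l i m * H m k + A l i m * (-(∑ n, A m j n * H n k) - ∑ n, H m n * A k j n)))
      - (∑ m, ((-(∑ n, A l j n * H n m) - ∑ n, H l n * A m j n) * A k i m + H l m * dA j k i m))) :
    ∑ a, (dA i l j a - dA j l i a + ∑ m, A l i m * A m j a - ∑ m, A l j m * A m i a) * H a k =
    - ∑ a, (dA i k j a - dA j k i a + ∑ m, A k i m * A m j a - ∑ m, A k j m * A m i a) * H a l := by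
  have h01 := hH 0 1
  have h02 := hH 0 2
  have h12 := hH 1 2
  have hl := fun a => hH l a
  simp only [Fin.sum_univ_three, hl] at h ⊢
  rw [h01, h02, h12] at h
  linear_combination -h

theorem Rup_antisymm_left (hg : IsRiemannian g) (x : E3) (l k i j : Fin 3) :
    Rup g x l k i j = - Rup g x k l i j := by
  have hder : ∀ i j, pd i (pd j (fun y => ginv g y l k)) x =
      - (∑ m, (pd i (fun y => Gamma g y l j m) x * ginv g x m k + Gamma g x l j m *
        (-(∑ n, Gamma g x m i n * ginv g x n k) - ∑ n, ginv g x m n * Gamma g x k i n)))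
      - (∑ m, ((-(∑ n, Gamma g x l i n * ginv g x n m) - ∑ n, ginv g x l n * Gamma g x m i n) *
        Gamma g x k j m + ginv g x l m * pd i (fun y => Gamma g y k j m) x)) := by
    intro i j
    have e : pd j (fun y => ginv g y l k) = fun y =>
        - (∑ m, Gamma g y l j m * ginv g y m k) - ∑ m, ginv g y l m * Gamma g y k j m :=
      funext fun y => compat_inv hg y j l k
    rw [e, pd_sub, pd_neg, pd_sum_mul, pd_sum_mul]
    · simp only [compat_inv hg]
    · exact fun m => sm_diff (sm_ginv hg l m) x
    · exact fun m => sm_diff (sm_Gamma hg k j m) x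
    · exact fun m => sm_diff (sm_Gamma hg l j m) x
    · exact fun m => sm_diff (sm_ginv hg m k) x
    · exact (sm_diff (ContDiff.sum fun m _ => (sm_Gamma hg l j m).mul (sm_ginv hg m k)) x).neg
    · exact (sm_diff (ContDiff.sum fun m _ => (sm_ginv hg l m).mul (sm_Gamma hg k j m)) x)
  have hc := pd_comm (sm_ginv hg l k).contDiffAt (x := x) i j
  rw [hder, hder] at hc
  exact alg_antisymm (fun a b c => Gamma g x a b c) (fun a b => ginv g x a b)
    (fun a b c d => pd a (fun y => Gamma g y b c d) x) l k i j (ginv_symm hg x) hc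

theorem alg_dim3 (P : Fin 3 → Fin 3 → Fin 3 → Fin 3 → ℝ)
    (h1 : ∀ l k i j, P l k i j = - P k l i j) (h2 : ∀ l k i j, P l k i j = - P l k j i)
    (S : Fin 3 → Fin 3 → ℝ)
    (hS : ∀ k j, S k j = ∑ l, P l k l j - (∑ m, ∑ l, P l m l m) / 4 * dl k j)
    (l k i j : Fin 3) :
    P l k i j = dl l i * S k j - dl l j * S k i + dl k j * S l i - dl k i * S l j := by
  have a1 : ∀ l i j, P l l i j = 0 := fun l i j => by linarith [h1 l l i j]
  have a2 : ∀ l k i, P l k i i = 0 := fun l k i => by linarith [h2 l k i i]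
  have b1 : ∀ i j, P 1 0 i j = - P 0 1 i j := h1 1 0
  have b2 : ∀ i j, P 2 0 i j = - P 0 2 i j := h1 2 0
  have b3 : ∀ i j, P 2 1 i j = - P 1 2 i j := h1 2 1
  have c1 : ∀ i j, P i j 1 0 = - P i j 0 1 := fun i j => h2 i j 1 0
  have c2 : ∀ i j, P i j 2 0 = - P i j 0 2 := fun i j => h2 i j 2 0
  have c3 : ∀ i j, P i j 2 1 = - P i j 1 2 := fun i j => h2 i j 2 1
  simp only [hS, Fin.sum_univ_three]
  clear hS h1 h2
  fin_cases l <;> fin_cases k <;> fin_cases i <;> fin_cases j <;>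
    simp [dl, a1, a2, b1, b2, b3, c1, c2, c3] <;> ring

/-- Schouten tensor with an index raised: `S^l_i`. -/
def Sup (g : Metric3) (x : E3) (l i : Fin 3) : ℝ := ∑ a, Schouten g x i a * ginv g x a l

theorem sum_Rup (x : E3) (k j : Fin 3) :
    ∑ l, Rup g x l k l j = ∑ a, Ricci g x j a * ginv g x a k := by
  unfold Rup Ricci
  simp only [Finset.sum_mul]
  rw [Finset.sum_comm]

theorem Rup_eq (hg : IsRiemannian g) (x : E3) (l k i j : Fin 3) :
    Rup g x l k i j = dl l i * Sup g x k j - dl l j * Sup g x k i + dl k j * Sup g x l i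
      - dl k i * Sup g x l j := by
  refine alg_dim3 (fun l k i j => Rup g x l k i j) (Rup_antisymm_left hg x) (Rup_antisymm_right x)
    (fun k j => Sup g x k j) ?_ l k i j
  intro k j
  simp only [sum_Rup]
  have hs : ∑ m, ∑ a, Ricci g x m a * ginv g x a m = Scal g x := by
    unfold Scal
    refine Finset.sum_congr rfl fun i _ => Finset.sum_congr rfl fun j _ => ?_
    rw [ginv_symm hg x j i, mul_comm]
  rw [hs]
  unfold Sup Schouten
  simp only [sub_mul, Finset.sum_sub_distrib, mul_assoc, ← Finset.mul_sum]
  rw [g_ginv hg, dl_comm]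

/-- In dimension three the curvature is determined by the Schouten tensor. -/
theorem Riemann_eq (hg : IsRiemannian g) (x : E3) (l i j k : Fin 3) :
    Riemann g x l i j k = dl l i * Schouten g x j k - dl l j * Schouten g x i k
      + g x j k * Sup g x l i - g x i k * Sup g x l j := by
  have h1 : ∑ b, Rup g x l b i j * g x b k = Riemann g x l i j k := by
    unfold Rup
    simp only [Finset.sum_mul]
    rw [Finset.sum_comm]
    simp only [mul_assoc, ← Finset.mul_sum, ginv_g hg, sum_mul_dl]
  have h2 : ∀ j, ∑ b, Sup g x b j * g x b k = Schouten g x j k := by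
    intro j
    unfold Sup
    simp only [Finset.sum_mul]
    rw [Finset.sum_comm]
    simp only [mul_assoc, ← Finset.mul_sum, ginv_g hg, sum_mul_dl]
  have h3 : ∀ j, ∑ b, dl b j * g x b k = g x j k := by
    intro j; simp [dl]
  rw [← h1]
  simp only [Rup_eq hg, sub_mul, add_mul, Finset.sum_add_distrib, Finset.sum_sub_distrib]
  have e1 : ∀ c j, ∑ b, c * Sup g x b j * g x b k = c * Schouten g x j k := by
    intro c j; rw [← h2, Finset.mul_sum]; simp only [mul_assoc]
  have e2 : ∀ c j, ∑ b, dl b j * c * g x b k = g x j k * c := by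
    intro c j; rw [← h3, Finset.sum_mul]
    exact Finset.sum_congr rfl fun b _ => by ring
  rw [e1, e1, e2, e2]

theorem bianchi (hg : IsRiemannian g) (x : E3) (l i j k : Fin 3) :
    Riemann g x l i j k + Riemann g x l j k i + Riemann g x l k i j = 0 := by
  have s : ∀ a b c, (fun y => Gamma g y a b c) = fun y => Gamma g y a c b :=
    fun a b c => funext fun y => Gamma_symm hg y a b c
  have s' : ∀ a b c, Gamma g x a b c = Gamma g x a c b := Gamma_symm hg x
  unfold Riemann
  rw [s l k j, s l k i, s l j i]
  simp only [s' _ k j, s' _ k i, s' _ j i]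
  ring

theorem sum_Riemann_trace (hg : IsRiemannian g) (x : E3) (i j : Fin 3) :
    ∑ l, Riemann g x l i j l = 0 := by
  have h1 : ∀ l, Riemann g x l i j l = ∑ b, Rup g x l b i j * g x b l := by
    intro l
    unfold Rup
    simp only [Finset.sum_mul]
    rw [Finset.sum_comm]
    simp only [mul_assoc, ← Finset.mul_sum, ginv_g hg, sum_mul_dl]
  simp only [h1]
  have h2 : ∑ l, ∑ b, Rup g x l b i j * g x b l = - ∑ l, ∑ b, Rup g x l b i j * g x b l := by
    conv_lhs => rw [Finset.sum_comm]
    rw [← Finset.sum_neg_distrib]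
    refine Finset.sum_congr rfl fun a _ => ?_
    rw [← Finset.sum_neg_distrib]
    refine Finset.sum_congr rfl fun b _ => ?_
    rw [Rup_antisymm_left hg, hg.symm x a b]; ring
  linarith

theorem Ricci_symm (hg : IsRiemannian g) (x : E3) (i j : Fin 3) : Ricci g x i j = Ricci g x j i := by
  have h := sum_Riemann_trace hg x i j
  have h2 : ∑ l, (Riemann g x l l i j + Riemann g x l i j l + Riemann g x l j l i) = 0 :=
    Finset.sum_eq_zero fun l _ => bianchi hg x l l i j
  have h3 : ∑ l, Riemann g x l j l i = - Ricci g x j i := by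
    unfold Ricci
    rw [← Finset.sum_neg_distrib]
    exact Finset.sum_congr rfl fun l _ => Riemann_antisymm x l j l i
  simp only [Finset.sum_add_distrib] at h2
  rw [h, h3] at h2
  have : Ricci g x i j = ∑ l, Riemann g x l l i j := rfl
  linarith

theorem Sch_symm (hg : IsRiemannian g) (x : E3) (i j : Fin 3) :
    Schouten g x i j = Schouten g x j i := by
  unfold Schouten; rw [Ricci_symm hg, hg.symm x i j]

/-- Index raising of a covector field. -/
def Uf (g : Metric3) (X : Fin 3 → E3 → ℝ) (a : Fin 3) (y : E3) : ℝ := ∑ b, ginv g y a b * X b y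

/-- Squared norm of a covector field. -/
def qf (g : Metric3) (X : Fin 3 → E3 → ℝ) (y : E3) : ℝ := ∑ a, X a y * Uf g X a y

/-- Covariant derivative of a covector field. -/
def Nf (g : Metric3) (X : Fin 3 → E3 → ℝ) (l m : Fin 3) (x : E3) : ℝ :=
  pd l (X m) x - ∑ n, Gamma g x n l m * X n x

/-- Right-hand side of the overdetermined system. -/
def FX (g : Metric3) (X : Fin 3 → E3 → ℝ) (k j : Fin 3) (y : E3) : ℝ :=
  ∑ m, Gamma g y m k j * X m y + Schouten g y k j + X k y * X j y - (1 / 2) * (qf g X y * g y k j)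

theorem diff_Uf (hg : IsRiemannian g) {X : Fin 3 → E3 → ℝ} {x : E3}
    (hX : ∀ m, DifferentiableAt ℝ (X m) x) (a : Fin 3) : DifferentiableAt ℝ (Uf g X a) x := by
  unfold Uf
  exact DifferentiableAt.fun_sum fun b _ => (sm_diff (sm_ginv hg a b) x).mul (hX b)

theorem diff_qf (hg : IsRiemannian g) {X : Fin 3 → E3 → ℝ} {x : E3}
    (hX : ∀ m, DifferentiableAt ℝ (X m) x) : DifferentiableAt ℝ (qf g X) x := by
  unfold qf
  exact DifferentiableAt.fun_sum fun b _ => (hX b).mul (diff_Uf hg hX b)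

theorem low_Uf (hg : IsRiemannian g) (X : Fin 3 → E3 → ℝ) (x : E3) (i : Fin 3) :
    ∑ m, g x i m * Uf g X m x = X i x := lower_raise hg x (fun m => X m x) i

theorem pd_Uf (hg : IsRiemannian g) {X : Fin 3 → E3 → ℝ} {x : E3}
    (hX : ∀ m, DifferentiableAt ℝ (X m) x) (k a : Fin 3) :
    pd k (Uf g X a) x = ∑ m, ginv g x a m * Nf g X k m x - ∑ b, Gamma g x a k b * Uf g X b x := by
  unfold Uf
  rw [pd_sum_mul k (fun m => sm_diff (sm_ginv hg a m) x) hX]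
  simp only [compat_inv hg, Nf, Fin.sum_univ_three]
  ring

theorem pd_qf (hg : IsRiemannian g) {X : Fin 3 → E3 → ℝ} {x : E3}
    (hX : ∀ m, DifferentiableAt ℝ (X m) x) (k : Fin 3) :
    pd k (qf g X) x = 2 * ∑ m, Uf g X m x * Nf g X k m x := by
  unfold qf
  rw [pd_sum_mul k hX (diff_Uf hg hX)]
  simp only [pd_Uf hg hX]
  have h1 : ∑ a, X a x * ∑ m, ginv g x a m * Nf g X k m x = ∑ m, Uf g X m x * Nf g X k m x := by
    unfold Uf
    simp only [Finset.mul_sum, Finset.sum_mul]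
    rw [Finset.sum_comm]
    refine Finset.sum_congr rfl fun a _ => Finset.sum_congr rfl fun b _ => ?_
    rw [ginv_symm hg x a b]; ring
  have h2 : ∀ m, pd k (X m) x = Nf g X k m x + ∑ n, Gamma g x n k m * X n x := by
    intro m; unfold Nf; ring
  simp only [h2]
  have h3 : ∑ m, ((Nf g X k m x + ∑ n, Gamma g x n k m * X n x) * Uf g X m x +
      X m x * (∑ n, ginv g x m n * Nf g X k n x - ∑ b, Gamma g x m k b * Uf g X b x)) =
      ∑ m, Uf g X m x * Nf g X k m x + ∑ a, X a x * ∑ m, ginv g x a m * Nf g X k m x := by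
    simp only [Fin.sum_univ_three]; ring
  rw [h3, h1]; ring

theorem alg_int (Γ : Fin 3 → Fin 3 → Fin 3 → ℝ) (dΓ : Fin 3 → Fin 3 → Fin 3 → Fin 3 → ℝ)
    (S g F : Fin 3 → Fin 3 → ℝ) (dS dg : Fin 3 → Fin 3 → Fin 3 → ℝ) (X V dq : Fin 3 → ℝ) (q : ℝ)
    (l k j : Fin 3)
    (hΓ : ∀ a b c, Γ a b c = Γ a c b) (hS : ∀ a b, S a b = S b a) (hgs : ∀ a b, g a b = g b a)
    (hdg : ∀ a b c, dg a b c = ∑ m, Γ m a b * g m c + ∑ m, Γ m a c * g b m)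
    (hF : ∀ a b, F a b = ∑ m, Γ m a b * X m + S a b + X a * X b - (1 / 2) * (q * g a b))
    (hdq : ∀ a, dq a = 2 * V a + q * X a)
    (hR : ∑ m, X m * (dΓ l m k j - dΓ k m l j + ∑ a, Γ m l a * Γ a k j - ∑ a, Γ m k a * Γ a l j) =
      X l * S k j - X k * S l j + g k j * V l - g l j * V k) :
    (∑ m, (dΓ l m k j * X m + Γ m k j * F l m) + dS l k j + (F l k * X j + X k * F l j)
      - (1 / 2) * (dq l * g k j + q * dg l k j)) -
    (∑ m, (dΓ k m l j * X m + Γ m l j * F k m) + dS k l j + (F k l * X j + X l * F k j)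
      - (1 / 2) * (dq k * g l j + q * dg k l j)) =
    (dS l k j - ∑ m, Γ m l k * S m j - ∑ m, Γ m l j * S k m) -
    (dS k l j - ∑ m, Γ m k l * S m j - ∑ m, Γ m k j * S l m) := by
  have hFs : F k l = F l k := by rw [hF, hF, hS k l, hgs k l]; simp only [hΓ _ k l]; ring
  rw [hFs]
  simp only [hF, hdg, hdq, Fin.sum_univ_three, hΓ _ k l] at hR ⊢
  linear_combination hR

theorem int_lemma (hg : IsRiemannian g) {X : Fin 3 → E3 → ℝ} {x : E3}
    (hX : ∀ m, DifferentiableAt ℝ (X m) x) (hF : ∀ k j, pd k (X j) x = FX g X k j x)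
    (l k j : Fin 3) :
    pd l (FX g X k j) x - pd k (FX g X l j) x = CottonForm g x l k j := by
  have hder : ∀ l k, pd l (FX g X k j) x =
      ∑ m, (pd l (fun y => Gamma g y m k j) x * X m x + Gamma g x m k j * FX g X l m x)
      + pd l (fun y => Schouten g y k j) x + (FX g X l k x * X j x + X k x * FX g X l j x)
      - (1 / 2) * (pd l (qf g X) x * g x k j + qf g X x * pd l (fun y => g y k j) x) := by
    intro l k
    have e : FX g X k j = fun y => ∑ m, Gamma g y m k j * X m y + Schouten g y k j + X k y * X j y
      - (1 / 2) * (qf g X y * g y k j) := rfl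
    have d1 : DifferentiableAt ℝ (fun y => ∑ m, Gamma g y m k j * X m y) x :=
      DifferentiableAt.fun_sum fun b _ => (sm_diff (sm_Gamma hg b k j) x).mul (hX b)
    have d2 := sm_diff (sm_Sch hg k j) x
    have d3 : DifferentiableAt ℝ (fun y => X k y * X j y) x := (hX k).mul (hX j)
    have d4 : DifferentiableAt ℝ (fun y => qf g X y * g y k j) x :=
      (diff_qf hg hX).mul (sm_diff (sm_g hg k j) x)
    rw [e, pd_sub l ((d1.fun_add d2).fun_add d3) (d4.const_mul _), pd_add l (d1.fun_add d2) d3,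
      pd_add l d1 d2, pd_const_mul l _ d4,
      pd_sum_mul l (fun m => sm_diff (sm_Gamma hg m k j) x) hX, pd_mul l (hX k) (hX j),
      pd_mul l (diff_qf hg hX) (sm_diff (sm_g hg k j) x)]
    simp only [hF]
  rw [hder, hder]
  unfold CottonForm covDeriv
  refine alg_int (fun a b c => Gamma g x a b c) (fun a b c d => pd a (fun y => Gamma g y b c d) x)
    (fun a b => Schouten g x a b) (fun a b => g x a b) (fun a b => FX g X a b x)
    (fun a b c => pd a (fun y => Schouten g y b c) x) (fun a b c => pd a (fun y => g y b c) x)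
    (fun a => X a x) (fun a => ∑ b, Schouten g x a b * Uf g X b x) (fun a => pd a (qf g X) x)
    (qf g X x) l k j (Gamma_symm hg x) (Sch_symm hg x) (hg.symm x) (compat hg x)
    (fun a b => rfl) ?_ ?_
  · intro a
    rw [pd_qf hg hX]
    have hN : ∀ m, Nf g X a m x = Schouten g x a m + X a x * X m x
        - (1 / 2) * (qf g X x * g x a m) := by
      intro m; unfold Nf; rw [hF]; unfold FX; ring
    have h1 := low_Uf hg X x a
    have h2 : qf g X x = ∑ m, X m x * Uf g X m x := rfl
    simp only [hN]
    have h3 : ∑ m, Uf g X m x * (Schouten g x a m + X a x * X m x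
        - (1 / 2) * (qf g X x * g x a m)) = ∑ m, Schouten g x a m * Uf g X m x
        + X a x * (∑ m, X m x * Uf g X m x) - (1 / 2) * qf g X x * ∑ m, g x a m * Uf g X m x := by
      simp only [Fin.sum_univ_three]; ring
    rw [h3, h1, ← h2]; ring
  · have hR : ∀ m, pd l (fun y => Gamma g y m k j) x - pd k (fun y => Gamma g y m l j) x
        + ∑ a, Gamma g x m l a * Gamma g x a k j - ∑ a, Gamma g x m k a * Gamma g x a l j =
        Riemann g x m l k j := fun m => rfl
    simp only [hR, Riemann_eq hg]
    have hV : ∀ a, ∑ m, X m x * Sup g x m a = ∑ b, Schouten g x a b * Uf g X b x := by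
      intro a
      unfold Sup Uf
      simp only [Finset.mul_sum]
      rw [Finset.sum_comm]
      refine Finset.sum_congr rfl fun b _ => Finset.sum_congr rfl fun c _ => ?_
      ring
    have hD : ∀ a, ∑ m, X m x * dl m a = X a x := fun a => sum_mul_dl a (fun m => X m x)
    rw [← hV, ← hV, ← hD l, ← hD k]
    simp only [Fin.sum_univ_three]; ring

theorem ginv_hat (f : E3 → ℝ) (y : E3) (i j : Fin 3) :
    ginv (fun z a b => Real.exp (2 * f z) * g z a b) y i j = Real.exp (-(2 * f y)) * ginv g y i j := by
  unfold ginv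
  have e : Matrix.of (fun a b => Real.exp (2 * f y) * g y a b) =
      (Real.exp (2 * f y)) • Matrix.of (g y) := by
    ext a b; simp
  rw [e]
  by_cases hu : IsUnit (Matrix.of (g y)).det
  · have := Matrix.inv_smul' (A := Matrix.of (g y)) (Units.mk0 (Real.exp (2 * f y)) (Real.exp_ne_zero _)) hu
    have h2 : (Real.exp (2 * f y) • Matrix.of (g y))⁻¹ =
      (Units.mk0 (Real.exp (2 * f y)) (Real.exp_ne_zero _))⁻¹ • (Matrix.of (g y))⁻¹ := this
    rw [h2, Real.exp_neg]; rfl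
  · rw [Matrix.nonsing_inv_apply_not_isUnit _ hu, Matrix.nonsing_inv_apply_not_isUnit]
    · simp
    · rw [Matrix.det_smul]
      intro h
      exact hu (isUnit_of_mul_isUnit_right h)

theorem pd_hat (hg : IsRiemannian g) {f : E3 → ℝ} {y : E3} (hf : DifferentiableAt ℝ f y)
    (k i j : Fin 3) :
    pd k (fun z => Real.exp (2 * f z) * g z i j) y =
      Real.exp (2 * f y) * (2 * pd k f y * g y i j + pd k (fun z => g z i j) y) := by
  have he : pd k (fun z => Real.exp (2 * f z)) y = Real.exp (2 * f y) * (2 * pd k f y) := by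
    unfold pd
    rw [fderiv_exp (hf.const_mul 2), fderiv_const_mul hf]
    simp
  rw [pd_mul k (by fun_prop) (sm_diff (sm_g hg i j) y), he]
  ring

theorem Gamma_hat (hg : IsRiemannian g) {f : E3 → ℝ} {y : E3} (hf : DifferentiableAt ℝ f y)
    (k i j : Fin 3) :
    Gamma (fun z a b => Real.exp (2 * f z) * g z a b) y k i j =
      Gamma g y k i j + dl k i * pd j f y + dl k j * pd i f y
        - g y i j * Uf g (fun m => pd m f) k y := by
  have h1 : ∀ i, ∑ l, ginv g y k l * g y i l = dl k i := by
    intro i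
    rw [← ginv_g hg y k i]
    exact Finset.sum_congr rfl fun l _ => by rw [hg.symm y i l]
  rw [← h1, ← h1]
  unfold Gamma Uf
  simp only [ginv_hat, pd_hat hg hf]
  have hee : Real.exp (-(2 * f y)) * Real.exp (2 * f y) = 1 := by
    rw [← Real.exp_add]; simp
  have h2 : ∀ l, Real.exp (-(2 * f y)) * ginv g y k l *
      (Real.exp (2 * f y) * (2 * pd i f y * g y j l + pd i (fun z => g z j l) y)
      + Real.exp (2 * f y) * (2 * pd j f y * g y i l + pd j (fun z => g z i l) y)
      - Real.exp (2 * f y) * (2 * pd l f y * g y i j + pd l (fun z => g z i j) y)) =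
      ginv g y k l * ((2 * pd i f y * g y j l + pd i (fun z => g z j l) y)
      + (2 * pd j f y * g y i l + pd j (fun z => g z i l) y)
      - (2 * pd l f y * g y i j + pd l (fun z => g z i j) y)) := by
    intro l
    linear_combination (ginv g y k l * ((2 * pd i f y * g y j l + pd i (fun z => g z j l) y)
      + (2 * pd j f y * g y i l + pd j (fun z => g z i l) y)
      - (2 * pd l f y * g y i j + pd l (fun z => g z i j) y))) * hee
  simp only [h2, Fin.sum_univ_three]
  ring

theorem alg_right (T X U : Fin 3 → ℝ) (G : Fin 3 → ℝ) (c : ℝ) (j k : Fin 3) :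
    ∑ m, T m * (G m + dl m j * X k + dl m k * X j - c * U m) =
      ∑ m, T m * G m + T j * X k + T k * X j - c * ∑ m, T m * U m := by
  rw [← sum_mul_dl j T, ← sum_mul_dl k T]
  simp only [Fin.sum_univ_three]; ring

theorem alg_left (T X U γ : Fin 3 → ℝ) (gi : Fin 3 → ℝ) (i l : Fin 3) :
    ∑ m, (γ m + dl l i * X m + dl l m * X i - gi m * U l) * T m =
      ∑ m, γ m * T m + dl l i * ∑ m, X m * T m + T l * X i - U l * ∑ m, gi m * T m := by
  rw [← sum_dl_mul l T]
  simp only [Fin.sum_univ_three]; ring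

theorem alg_conf (Γ : Fin 3 → Fin 3 → Fin 3 → ℝ) (dΓ : Fin 3 → Fin 3 → Fin 3 → Fin 3 → ℝ)
    (g N NU dU dX : Fin 3 → Fin 3 → ℝ) (dg : Fin 3 → Fin 3 → Fin 3 → ℝ) (X U : Fin 3 → ℝ) (q : ℝ)
    (l i j k : Fin 3)
    (hΓ : ∀ a b c, Γ a b c = Γ a c b) (hgs : ∀ a b, g a b = g b a)
    (hdg : ∀ a b c, dg a b c = ∑ m, Γ m a b * g m c + ∑ m, Γ m a c * g b m)
    (hdX : ∀ a b, dX a b = N a b + ∑ m, Γ m a b * X m)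
    (hdXs : ∀ a b, dX a b = dX b a)
    (hdU : ∀ a b, dU a b = NU a b - ∑ m, Γ b a m * U m)
    (hq : q = ∑ m, X m * U m)
    (hU : ∀ a, ∑ m, g a m * U m = X a) :
    (dΓ i l j k + dl l j * dX i k + dl l k * dX i j - (dg i j k * U l + g j k * dU i l)) -
    (dΓ j l i k + dl l i * dX j k + dl l k * dX j i - (dg j i k * U l + g i k * dU j l)) +
    ∑ m, (Γ l i m + dl l i * X m + dl l m * X i - g i m * U l) *
      (Γ m j k + dl m j * X k + dl m k * X j - g j k * U m) -
    ∑ m, (Γ l j m + dl l j * X m + dl l m * X j - g j m * U l) *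
      (Γ m i k + dl m i * X k + dl m k * X i - g i k * U m) =
    (dΓ i l j k - dΓ j l i k + ∑ m, Γ l i m * Γ m j k - ∑ m, Γ l j m * Γ m i k) +
    (dl l j * (N i k - X i * X k + (1 / 2) * (q * g i k))
      - dl l i * (N j k - X j * X k + (1 / 2) * (q * g j k))
      + g i k * (NU j l - X j * U l + (1 / 2) * (q * dl l j))
      - g j k * (NU i l - X i * U l + (1 / 2) * (q * dl l i))) := by
  simp only [alg_right, alg_left, hU, ← hq]
  rw [hdXs j i, hgs j i]
  simp only [hdX i k, hdX j k, hdg, hdU, Fin.sum_univ_three, hΓ _ j i, hgs _ k]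
  ring

theorem Riemann_hat (hg : IsRiemannian g) {f : E3 → ℝ} {x : E3}
    (hf : ContDiffAt ℝ (⊤ : ℕ∞) f x) (l i j k : Fin 3) :
    Riemann (fun z a b => Real.exp (2 * f z) * g z a b) x l i j k =
      dl l i * (FX g (fun m => pd m f) j k x - pd j (pd k f) x)
      - dl l j * (FX g (fun m => pd m f) i k x - pd i (pd k f) x)
      + g x j k * (∑ a, (FX g (fun m => pd m f) i a x - pd i (pd a f) x) * ginv g x a l)
      - g x i k * (∑ a, (FX g (fun m => pd m f) j a x - pd j (pd a f) x) * ginv g x a l) := by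
  set X : Fin 3 → E3 → ℝ := fun m => pd m f with hXdef
  have hX : ∀ m, DifferentiableAt ℝ (X m) x := fun m => smAt_diff (pd_contDiffAt hf m)
  have hev : ∀ᶠ y in nhds x, DifferentiableAt ℝ f y := by
    have h1 := (hf.of_le (by exact_mod_cast le_top : (1 : WithTop ℕ∞) ≤ ((⊤ : ℕ∞) : WithTop ℕ∞))).eventually
      (by simp)
    filter_upwards [h1] with y hy
    exact hy.differentiableAt (by simp)
  have hder : ∀ a j k, pd a (fun y => Gamma (fun z a b => Real.exp (2 * f z) * g z a b) y l j k) x =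
      pd a (fun y => Gamma g y l j k) x + dl l j * pd a (X k) x + dl l k * pd a (X j) x
      - (pd a (fun y => g y j k) x * Uf g X l x + g x j k * pd a (Uf g X l) x) := by
    intro a j k
    rw [pd_congr (b := fun y => Gamma g y l j k + dl l j * X k y + dl l k * X j y
        - g y j k * Uf g X l y) (by
      filter_upwards [hev] with y hy
      exact Gamma_hat hg hy l j k)]
    have d1 := sm_diff (sm_Gamma hg l j k) x
    have d2 : DifferentiableAt ℝ (fun y => dl l j * X k y) x := (hX k).const_mul _
    have d3 : DifferentiableAt ℝ (fun y => dl l k * X j y) x := (hX j).const_mul _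
    have d4 : DifferentiableAt ℝ (fun y => g y j k * Uf g X l y) x :=
      (sm_diff (sm_g hg j k) x).mul (diff_Uf hg hX l)
    rw [pd_sub a ((d1.fun_add d2).fun_add d3) d4, pd_add a (d1.fun_add d2) d3, pd_add a d1 d2,
      pd_const_mul a _ (hX k), pd_const_mul a _ (hX j),
      pd_mul a (sm_diff (sm_g hg j k) x) (diff_Uf hg hX l)]
  have hmain := alg_conf (fun a b c => Gamma g x a b c)
    (fun a b c d => pd a (fun y => Gamma g y b c d) x) (fun a b => g x a b)
    (fun a b => Nf g X a b x) (fun a b => ∑ m, ginv g x b m * Nf g X a m x)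
    (fun a b => pd a (Uf g X b) x) (fun a b => pd a (X b) x)
    (fun a b c => pd a (fun y => g y b c) x) (fun a => X a x) (fun a => Uf g X a x) (qf g X x)
    l i j k (Gamma_symm hg x) (hg.symm x) (compat hg x)
    (fun a b => by unfold Nf; ring) (fun a b => pd_comm hf a b)
    (fun a b => pd_Uf hg hX a b) rfl (fun a => low_Uf hg X x a)
  have hR : pd i (fun y => Gamma g y l j k) x - pd j (fun y => Gamma g y l i k) x
        + ∑ a, Gamma g x l i a * Gamma g x a j k - ∑ a, Gamma g x l j a * Gamma g x a i k =
        Riemann g x l i j k := rfl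
  unfold Riemann
  rw [hder, hder]
  simp only [Gamma_hat hg hev.self_of_nhds]
  refine hmain.trans ?_
  rw [hR, Riemann_eq hg]
  have hT : ∀ a b, FX g X a b x - pd a (pd b f) x = Schouten g x a b -
      (Nf g X a b x - X a x * X b x + (1 / 2) * (qf g X x * g x a b)) := by
    intro a b; unfold FX Nf; ring
  simp only [hT]
  have hTu : ∀ i, ∑ a, (Schouten g x i a - (Nf g X i a x - X i x * X a x
      + (1 / 2) * (qf g X x * g x i a))) * ginv g x a l = Sup g x l i -
      (∑ m, ginv g x l m * Nf g X i m x - X i x * Uf g X l x + (1 / 2) * (qf g X x * dl l i)) := by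
    intro i
    have h1 := g_ginv hg x i l
    rw [dl_comm] at h1
    rw [← h1]
    unfold Sup Uf
    simp only [Fin.sum_univ_three, ginv_symm hg x l]
    ring
  simp only [hTu]
  ring

theorem alg_flat (T g H : Fin 3 → Fin 3 → ℝ) (hgH : ∀ i j, ∑ l, g i l * H l j = dl i j)
    (hHg : ∀ i j, ∑ l, H i l * g l j = dl i j)
    (h : ∀ l i j k, dl l i * T j k - dl l j * T i k + g j k * (∑ a, T i a * H a l)
      - g i k * (∑ a, T j a * H a l) = 0) (j k : Fin 3) : T j k = 0 := by
  set t := ∑ l, ∑ a, T l a * H a l with ht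
  have h1 : ∀ j k, T j k + g j k * t = 0 := by
    intro j k
    have h2 : ∑ l, (dl l l * T j k - dl l j * T l k + g j k * (∑ a, T l a * H a l)
      - g l k * (∑ a, T j a * H a l)) = 0 := Finset.sum_eq_zero fun l _ => h l l j k
    simp only [Finset.sum_sub_distrib, Finset.sum_add_distrib, ← Finset.mul_sum] at h2
    have e1 : ∑ l, dl l l * T j k = 3 * T j k := by simp [dl]
    have e2 : ∑ l, dl l j * T l k = T j k := by simp [dl]
    have e3 : ∑ l, g l k * ∑ a, T j a * H a l = T j k := by
      rw [← sum_mul_dl k (T j)]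
      simp only [← hHg, Fin.sum_univ_three]
      ring
    rw [e1, e2, e3] at h2
    linarith
  have h3 : t = -(3 * t) := by
    have e4 : ∑ l, ∑ a, g l a * H a l = 3 := by
      simp only [hgH]; simp [dl]
    have e5 : ∀ l a, T l a = -(g l a * t) := fun l a => by linarith [h1 l a]
    have e6 : t = -((∑ l, ∑ a, g l a * H a l) * t) := by
      conv_lhs => rw [ht]
      simp only [e5, Fin.sum_univ_three]
      ring
    rw [e4] at e6
    exact e6
  have h4 : t = 0 := by linarith
  have := h1 j k
  rw [h4] at this
  linarith

theorem symm_of_basis {N : Type*} [NormedAddCommGroup N] [NormedSpace ℝ N]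
    (B : E3 →L[ℝ] E3 →L[ℝ] N)
    (h : ∀ l k : Fin 3, B (Pi.single l 1) (Pi.single k 1) = B (Pi.single k 1) (Pi.single l 1))
    (u v : E3) : B u v = B v u := by
  have e : ∀ w : E3, w = ∑ k, w k • (Pi.single k 1 : E3) := by
    intro w
    funext i
    simp [Finset.sum_apply, Pi.single_apply]
  rw [e u, e v]
  simp only [map_sum, _root_.sum_apply, map_smul, _root_.smul_apply]
  simp only [Fin.sum_univ_three]
  rw [h 1 0, h 2 0, h 2 1]
  module

/-- Value of the right-hand side of the system at a point of the extended phase space. -/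
def Fpt (g : Metric3) (k j : Fin 3) (p : E3 × (ℝ × E3)) : ℝ := FX g (fun m _ => p.2.2 m) k j p.1

theorem sm_Fpt (hg : IsRiemannian g) (k j : Fin 3) : ContDiff ℝ (⊤ : ℕ∞) (Fpt g k j) := by
  have hc : ∀ m, ContDiff ℝ (⊤ : ℕ∞) (fun p : E3 × (ℝ × E3) => p.2.2 m) := by
    intro m; fun_prop
  have h1 : ∀ {h : E3 → ℝ}, ContDiff ℝ (⊤ : ℕ∞) h →
      ContDiff ℝ (⊤ : ℕ∞) (fun p : E3 × (ℝ × E3) => h p.1) := fun hh => hh.comp contDiff_fst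
  unfold Fpt FX qf Uf
  refine ContDiff.sub (ContDiff.add (ContDiff.add (ContDiff.sum fun m _ => ?_) ?_) ?_) ?_
  · exact (h1 (sm_Gamma hg m k j)).mul (hc m)
  · exact h1 (sm_Sch hg k j)
  · exact (hc k).mul (hc j)
  · refine contDiff_const.mul (ContDiff.mul (ContDiff.sum fun a _ => (hc a).mul
      (ContDiff.sum fun b _ => (h1 (sm_ginv hg a b)).mul (hc b))) (h1 (sm_g hg k j)))

theorem FX_eq_Fpt (X : Fin 3 → E3 → ℝ) (k j : Fin 3) (y : E3) (p : E3 × (ℝ × E3))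
    (h1 : p.1 = y) (h2 : ∀ m, p.2.2 m = X m y) : FX g X k j y = Fpt g k j p := by
  subst h1
  unfold Fpt FX qf Uf
  simp only [h2]

theorem FX_symm (hg : IsRiemannian g) (X : Fin 3 → E3 → ℝ) (k j : Fin 3) (y : E3) :
    FX g X k j y = FX g X j k y := by
  unfold FX
  rw [Sch_symm hg y k j, hg.symm y k j]
  simp only [Gamma_symm hg y _ k j]
  ring

/-- The total differential system. -/
def FF (g : Metric3) (p : E3 × (ℝ × E3)) : E3 →L[ℝ] ℝ × E3 :=
  ∑ k, (ContinuousLinearMap.proj (R := ℝ) (φ := fun _ : Fin 3 => ℝ) k).smulRight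
    ((p.2.2 k, fun j => Fpt g k j p) : ℝ × E3)

theorem FF_single (p : E3 × (ℝ × E3)) (k : Fin 3) :
    FF g p (Pi.single k 1) = (p.2.2 k, fun j => Fpt g k j p) := by
  unfold FF
  rw [_root_.sum_apply, Finset.sum_eq_single k]
  · simp
  · intro b _ hb; simp [hb]
  · simp

theorem sm_FF (hg : IsRiemannian g) : ContDiff ℝ (⊤ : ℕ∞) (FF g) := by
  unfold FF
  refine ContDiff.sum fun k _ => ContDiff.smulRight contDiff_const (ContDiff.prodMk (by fun_prop) ?_)
  exact contDiff_pi.2 fun j => sm_Fpt hg k j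

theorem FF_int (hg : IsRiemannian g) (hC : ∀ x k i j, CottonForm g x k i j = 0)
    (p : E3 × (ℝ × E3)) (u v : E3) :
    fderiv ℝ (FF g) p (u, FF g p u) v = fderiv ℝ (FF g) p (v, FF g p v) u := by
  have hd : Differentiable ℝ (FF g) := (sm_FF hg).differentiable (by simp)
  let Y : E3 → ℝ × E3 := fun y => p.2 + FF g p (y - p.1)
  have hY : HasFDerivAt Y (FF g p) p.1 := by
    have h0 : HasFDerivAt (fun y : E3 => y - p.1) (ContinuousLinearMap.id ℝ E3) p.1 :=
      (hasFDerivAt_id p.1).sub_const p.1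
    have := (FF g p).hasFDerivAt.comp p.1 h0
    rw [ContinuousLinearMap.comp_id] at this
    exact this.const_add p.2
  have hY0 : Y p.1 = p.2 := by simp [Y]
  let X : Fin 3 → E3 → ℝ := fun m y => (Y y).2 m
  have hX : ∀ m, HasFDerivAt (X m) ((ContinuousLinearMap.proj (R := ℝ) (φ := fun _ : Fin 3 => ℝ) m).comp
      ((ContinuousLinearMap.snd ℝ ℝ E3).comp (FF g p))) p.1 := by
    intro m
    exact (ContinuousLinearMap.proj (R := ℝ) (φ := fun _ : Fin 3 => ℝ) m).hasFDerivAt.comp p.1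
      ((ContinuousLinearMap.hasFDerivAt (ContinuousLinearMap.snd ℝ ℝ E3)).comp p.1 hY)
  have hXd : ∀ m, DifferentiableAt ℝ (X m) p.1 := fun m => (hX m).differentiableAt
  have hXF : ∀ k j, pd k (X j) p.1 = FX g X k j p.1 := by
    intro k j
    rw [FX_eq_Fpt X k j p.1 p rfl (fun m => by simp [X, hY0])]
    unfold pd
    rw [(hX j).fderiv]
    simp [FF_single]
  have hZ : HasFDerivAt (fun y => (y, Y y)) ((ContinuousLinearMap.id ℝ E3).prod (FF g p)) p.1 :=
    (hasFDerivAt_id p.1).prodMk hY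
  have hp : (p.1, Y p.1) = p := by rw [hY0]
  have hG : HasFDerivAt (fun y => FF g (y, Y y))
      ((fderiv ℝ (FF g) p).comp ((ContinuousLinearMap.id ℝ E3).prod (FF g p))) p.1 := by
    have h0 : HasFDerivAt (FF g) (fderiv ℝ (FF g) p) (p.1, Y p.1) := by
      rw [hp]; exact (hd p).hasFDerivAt
    exact h0.comp p.1 hZ
  set B := (fderiv ℝ (FF g) p).comp ((ContinuousLinearMap.id ℝ E3).prod (FF g p)) with hB
  have hk : ∀ k, HasFDerivAt (fun y => ((X k y, fun j => FX g X k j y) : ℝ × E3))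
      (B.flip (Pi.single k 1)) p.1 := by
    intro k
    have h1 : HasFDerivAt (fun y => FF g (y, Y y) (Pi.single k 1)) (B.flip (Pi.single k 1)) p.1 := by
      have := hG.clm_apply (hasFDerivAt_const (Pi.single k 1 : E3) p.1)
      rw [ContinuousLinearMap.comp_zero, zero_add] at this
      exact this
    refine h1.congr_of_eventuallyEq (Filter.Eventually.of_forall fun y => ?_)
    simp only [FF_single]
    refine Prod.ext rfl (funext fun j => ?_)
    exact FX_eq_Fpt X k j y (y, Y y) rfl (fun m => rfl)
  have h1 : ∀ k l, (B (Pi.single l 1) (Pi.single k 1)).1 = pd l (X k) p.1 := by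
    intro k l
    unfold pd
    rw [((hk k).fst : HasFDerivAt (X k) _ _).fderiv]
    rfl
  have h2 : ∀ k l j, (B (Pi.single l 1) (Pi.single k 1)).2 j = pd l (FX g X k j) p.1 := by
    intro k l j
    unfold pd
    have h3 : HasFDerivAt (FX g X k j) _ p.1 := (hasFDerivAt_pi'.1 (hk k).snd) j
    rw [h3.fderiv]
    rfl
  refine symm_of_basis B (fun l k => Prod.ext ?_ (funext fun j => ?_)) u v
  · rw [h1, h1, hXF, hXF, FX_symm hg]
  · have := int_lemma hg hXd hXF l k j
    rw [hC] at this
    rw [h2, h2]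
    linarith

theorem conf_flat_of_hess (hg : IsRiemannian g) {f : E3 → ℝ} {x : E3}
    (hf : ContDiffAt ℝ (⊤ : ℕ∞) f x)
    (h : ∀ a b, pd a (pd b f) x = FX g (fun m => pd m f) a b x) (l i j k : Fin 3) :
    Riemann (fun z a b => Real.exp (2 * f z) * g z a b) x l i j k = 0 := by
  rw [Riemann_hat hg hf]
  simp [h]

theorem hess_of_conf_flat (hg : IsRiemannian g) {f : E3 → ℝ} {x : E3}
    (hf : ContDiffAt ℝ (⊤ : ℕ∞) f x)
    (h : ∀ l i j k, Riemann (fun z a b => Real.exp (2 * f z) * g z a b) x l i j k = 0)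
    (a b : Fin 3) : pd a (pd b f) x = FX g (fun m => pd m f) a b x := by
  have := alg_flat (fun a b => FX g (fun m => pd m f) a b x - pd a (pd b f) x)
    (fun a b => g x a b) (fun a b => ginv g x a b) (g_ginv hg x) (ginv_g hg x)
    (fun l i j k => by rw [← h l i j k, Riemann_hat hg hf]) a b
  linarith

theorem cotton_zero (hg : IsRiemannian g) {V : Set E3} (hV : IsOpen V) {f : E3 → ℝ}
    (hf : ContDiffOn ℝ (⊤ : ℕ∞) f V)
    (h : ∀ y ∈ V, ∀ l i j k : Fin 3,
      Riemann (fun z a b => Real.exp (2 * f z) * g z a b) y l i j k = 0)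
    {x : E3} (hx : x ∈ V) (k i j : Fin 3) : CottonForm g x k i j = 0 := by
  have hfa : ∀ y ∈ V, ContDiffAt ℝ (⊤ : ℕ∞) f y := fun y hy => hf.contDiffAt (hV.mem_nhds hy)
  have hh : ∀ y ∈ V, ∀ a b, pd a (pd b f) y = FX g (fun m => pd m f) a b y :=
    fun y hy a b => hess_of_conf_flat hg (hfa y hy) (h y hy) a b
  have hXs : ∀ m, ContDiffAt ℝ (⊤ : ℕ∞) (pd m f) x := fun m => pd_contDiffAt (hfa x hx) m
  rw [← int_lemma hg (X := fun m => pd m f) (fun m => smAt_diff (hXs m)) (hh x hx) k i j]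
  have hc : ∀ l a b, pd l (FX g (fun m => pd m f) a b) x = pd l (pd a (pd b f)) x := by
    intro l a b
    refine pd_congr ?_
    filter_upwards [hV.mem_nhds hx] with y hy
    exact (hh y hy a b).symm
  rw [hc, hc, pd_comm (hXs j) k i, sub_self]

theorem conf_flat_of_cotton (hg : IsRiemannian g) (hC : ∀ x k i j, CottonForm g x k i j = 0)
    (x : E3) : ∃ V : Set E3, IsOpen V ∧ x ∈ V ∧ ∃ f : E3 → ℝ,
        ContDiffOn ℝ (⊤ : ℕ∞) f V ∧
        ∀ y ∈ V, ∀ l i j k : Fin 3,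
          Riemann (fun z a b => Real.exp (2 * f z) * g z a b) y l i j k = 0 := by
  obtain ⟨V, hV, hx, Y, hY⟩ := frob_main (FF g) (by exact_mod_cast contDiff_infty.1 (sm_FF hg) 2)
    (FF_int hg hC) x 0
  have hYs := frob_smooth (FF g) (sm_FF hg) V hV Y hY
  have hfs : ContDiffOn ℝ (⊤ : ℕ∞) (fun y => (Y y).1) V := contDiff_fst.comp_contDiffOn hYs
  refine ⟨V, hV, hx, fun y => (Y y).1, hfs, fun y hy => ?_⟩
  have h1 : ∀ z ∈ V, ∀ k, pd k (fun y => (Y y).1) z = (Y z).2 k := by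
    intro z hz k
    unfold pd
    rw [(hY z hz).fst.fderiv]
    simp [FF_single]
  refine conf_flat_of_hess hg (hfs.contDiffAt (hV.mem_nhds hy)) fun a b => ?_
  rw [FX_eq_Fpt _ a b y (y, Y y) rfl (fun m => (h1 y hy m).symm)]
  rw [pd_congr (b := fun z => (Y z).2 b) (by
    filter_upwards [hV.mem_nhds hy] with z hz
    exact h1 z hz b)]
  unfold pd
  have h3 : HasFDerivAt (fun z => (Y z).2 b) _ y := (hasFDerivAt_pi'.1 (hY y hy).snd) b
  rw [h3.fderiv]
  simp [FF_single]

end Geometry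

/-- A Riemannian metric `g` on a 3-manifold is locally conformally flat
(every point has an open neighborhood `V` and a smooth conformal factor `f` on `V`
such that `e^{2f} g` is flat on `V`) if and only if its Cotton form
`cott(g) = d^∇ Sch` vanishes identically. -/
theorem locally_conformally_flat_iff_cotton_vanishes (g : Metric3) (hg : IsRiemannian g) :
    (∀ x : E3, ∃ V : Set E3, IsOpen V ∧ x ∈ V ∧ ∃ f : E3 → ℝ,
        ContDiffOn ℝ (⊤ : ℕ∞) f V ∧
        ∀ y ∈ V, ∀ l i j k : Fin 3,
          Riemann (fun z a b => Real.exp (2 * f z) * g z a b) y l i j k = 0)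
      ↔ (∀ (x : E3) (k i j : Fin 3), CottonForm g x k i j = 0) := by
  constructor
  · intro h x k i j
    obtain ⟨V, hV, hx, f, hf, hR⟩ := h x
    exact cotton_zero hg hV hf hR hx k i j
  · intro hC x
    exact conf_flat_of_cotton hg hC x
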